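/- Let α : G^k → 𝔽₂ be a multilinear form, let U ≤ G be a subspace of codimension d, and let σ : U^k → 𝔽₂ be a symmetric multilinear form such that prank(α|_{U×⋯×U} + σ) ≤ r. Then there exists a symmetric multilinear form σ̃ : G^k → 𝔽₂ such that prank(α + σ̃) ≤ k·d + r. -/

import Mathlib

open Finset

/-- `β : (Fin k → V) → ZMod 2` is a multilinear form in the variables indexed by `S`:
it depends only on the coordinates in `S` and is additive (hence `𝔽₂`-linear) in each of
those coordinates. -/
def MultilinearOn {V : Type*} [AddCommGroup V] [Module (ZMod 2) V] (k : ℕ)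
    (S : Finset (Fin k)) (β : (Fin k → V) → ZMod 2) : Prop :=
  (∀ x y : Fin k → V, (∀ i ∈ S, x i = y i) → β x = β y) ∧
  (∀ i ∈ S, ∀ (x : Fin k → V) (u v : V),
    β (Function.update x i (u + v)) = β (Function.update x i u) + β (Function.update x i v))

/-- A multilinear form in all `k` variables. -/
def IsMultilinear {V : Type*} [AddCommGroup V] [Module (ZMod 2) V] (k : ℕ)
    (α : (Fin k → V) → ZMod 2) : Prop :=
  MultilinearOn k Finset.univ α

/-- `α`, a multilinear form in the variables indexed by `S`, admits a partition-rank
decomposition with `m` terms. -/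
def PrankDecompOn {V : Type*} [AddCommGroup V] [Module (ZMod 2) V] (k : ℕ)
    (S : Finset (Fin k)) (m : ℕ) (α : (Fin k → V) → ZMod 2) : Prop :=
  ∃ (I : Fin m → Finset (Fin k)) (β γ : Fin m → ((Fin k → V) → ZMod 2)),
    (∀ i, I i ⊆ S) ∧ (∀ i, I i ≠ ∅) ∧ (∀ i, I i ≠ S) ∧
    (∀ i, MultilinearOn k (I i) (β i)) ∧
    (∀ i, MultilinearOn k (S \ I i) (γ i)) ∧
    (∀ x, α x = ∑ i, β i x * γ i x)

/-- The partition rank of a multilinear form in the variables indexed by `S`. -/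
noncomputable def prankOn {V : Type*} [AddCommGroup V] [Module (ZMod 2) V] (k : ℕ)
    (S : Finset (Fin k)) (α : (Fin k → V) → ZMod 2) : ℕ :=
  sInf {m | PrankDecompOn k S m α}

/-- The partition rank of a multilinear form in `k` variables. -/
noncomputable def prank {V : Type*} [AddCommGroup V] [Module (ZMod 2) V] (k : ℕ)
    (α : (Fin k → V) → ZMod 2) : ℕ :=
  prankOn k Finset.univ α

/-- `α ∘ π`: the form `(x₁, …, x_k) ↦ α(x_{π⁻¹(1)}, …, x_{π⁻¹(k)})`. -/
def permForm {V : Type*} (k : ℕ) (π : Equiv.Perm (Fin k))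
    (α : (Fin k → V) → ZMod 2) : (Fin k → V) → ZMod 2 :=
  fun x => α (fun i => x (π.symm i))

/-- `α` is symmetric in its first `m` variables (0-indexed: coordinates `< m`). -/
def SymmetricInFirst {V : Type*} (k m : ℕ) (α : (Fin k → V) → ZMod 2) : Prop :=
  ∀ i j : Fin k, (i : ℕ) < m → (j : ℕ) < m → permForm k (Equiv.swap i j) α = α

/-- `α` is symmetric in all of its variables. -/
def SymmetricForm {V : Type*} (k : ℕ) (α : (Fin k → V) → ZMod 2) : Prop :=
  ∀ π : Equiv.Perm (Fin k), permForm k π α = α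

/-- `σ` is strongly symmetric: it is symmetric, and the form
`(x, y₃, …, y_k) ↦ σ(x, x, y₃, …, y_k)` is also symmetric.  (Given the symmetry of `σ`,
the latter is equivalent to being allowed to swap the doubled variable with the third
variable, which is how it is stated here.) -/
def StronglySymmetric {V : Type*} (k : ℕ) (σ : (Fin k → V) → ZMod 2) : Prop :=
  SymmetricForm k σ ∧
  ∀ (u v : V) (z : Fin k → V),
    σ (fun i => if (i : ℕ) = 0 ∨ (i : ℕ) = 1 then u else if (i : ℕ) = 2 then v else z i) =
    σ (fun i => if (i : ℕ) = 0 ∨ (i : ℕ) = 1 then v else if (i : ℕ) = 2 then u else z i)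

section PartitionRank

variable {V W : Type*} [AddCommGroup V] [Module (ZMod 2) V] [AddCommGroup W] [Module (ZMod 2) W]
  {k : ℕ} {S : Finset (Fin k)}

/-- A partition-rank decomposition may be indexed by any finite type. -/
theorem PrankDecompOn.of_fintype {ι : Type*} [Fintype ι] {α : (Fin k → V) → ZMod 2}
    (I : ι → Finset (Fin k)) (β γ : ι → (Fin k → V) → ZMod 2)
    (hS : ∀ i, I i ⊆ S) (h0 : ∀ i, I i ≠ ∅) (h1 : ∀ i, I i ≠ S)
    (hβ : ∀ i, MultilinearOn k (I i) (β i)) (hγ : ∀ i, MultilinearOn k (S \ I i) (γ i))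
    (h : ∀ x, α x = ∑ i, β i x * γ i x) :
    PrankDecompOn k S (Fintype.card ι) α := by
  let e := (Fintype.equivFin ι).symm
  refine ⟨I ∘ e, β ∘ e, γ ∘ e, fun i => hS _, fun i => h0 _, fun i => h1 _, fun i => hβ _,
    fun i => hγ _, fun x => ?_⟩
  rw [h x]
  exact (e.sum_comp fun i => β i x * γ i x).symm

theorem PrankDecompOn.add {a b : ℕ} {α α' : (Fin k → V) → ZMod 2}
    (h : PrankDecompOn k S a α) (h' : PrankDecompOn k S b α') :
    PrankDecompOn k S (a + b) (α + α') := by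
  obtain ⟨I, β, γ, h1, h2, h3, h4, h5, h6⟩ := h
  obtain ⟨I', β', γ', h1', h2', h3', h4', h5', h6'⟩ := h'
  have := PrankDecompOn.of_fintype (α := α + α') (Sum.elim I I') (Sum.elim β β') (Sum.elim γ γ')
    (Sum.rec h1 h1') (Sum.rec h2 h2') (Sum.rec h3 h3') (Sum.rec h4 h4') (Sum.rec h5 h5')
    (fun x => by simp [h6, h6'])
  simpa using this

theorem MultilinearOn.comp_linearMap {β : (Fin k → W) → ZMod 2} (hβ : MultilinearOn k S β)
    (P : V →ₗ[ZMod 2] W) : MultilinearOn k S fun x : Fin k → V => β fun i => P (x i) := by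
  refine ⟨fun x y hxy => hβ.1 _ _ fun i hi => by rw [hxy i hi], fun i hi x u v => ?_⟩
  have key : ∀ w, (fun j => P (Function.update x i w j)) =
      Function.update (fun j => P (x j)) i (P w) := fun w => by
    ext j
    exact Function.apply_update (fun _ => P) x i w j
  simp only [key, map_add]
  exact hβ.2 i hi _ _ _

theorem PrankDecompOn.comp_linearMap {m : ℕ} {α : (Fin k → W) → ZMod 2}
    (h : PrankDecompOn k S m α) (P : V →ₗ[ZMod 2] W) :
    PrankDecompOn k S m fun x : Fin k → V => α fun i => P (x i) := by
  obtain ⟨I, β, γ, h1, h2, h3, h4, h5, h6⟩ := h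
  exact ⟨I, fun i x => β i fun j => P (x j), fun i x => γ i fun j => P (x j), h1, h2, h3,
    fun i => (h4 i).comp_linearMap P, fun i => (h5 i).comp_linearMap P, fun x => h6 _⟩

/-- A multilinear form, as an additive map in one of its variables. -/
def MultilinearOn.slice {α : (Fin k → V) → ZMod 2} (hα : MultilinearOn k S α) (y : Fin k → V)
    {j : Fin k} (hj : j ∈ S) : V →+ ZMod 2 :=
  AddMonoidHom.mk' (fun u => α (Function.update y j u)) (hα.2 j hj y)

/-- `x` with its first `j` coordinates replaced by their images under `P`. -/
def mapPrefix (P : V →ₗ[ZMod 2] V) (j : ℕ) (x : Fin k → V) : Fin k → V :=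
  fun i => if (i : ℕ) < j then P (x i) else x i

theorem mapPrefix_update (P : V →ₗ[ZMod 2] V) (j : ℕ) (x : Fin k → V) (i : Fin k) (u : V) :
    mapPrefix P j (Function.update x i u) =
      Function.update (mapPrefix P j x) i (if (i : ℕ) < j then P u else u) := by
  ext l
  rcases eq_or_ne l i with rfl | h
  · simp [mapPrefix]
  · simp [mapPrefix, h]

theorem update_mapPrefix_self (P : V →ₗ[ZMod 2] V) (j : Fin k) (x : Fin k → V) :
    Function.update (mapPrefix P j x) j (x j) = mapPrefix P j x :=
  Function.update_eq_self_iff.2 (by simp [mapPrefix])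

theorem update_mapPrefix_map (P : V →ₗ[ZMod 2] V) (j : Fin k) (x : Fin k → V) :
    Function.update (mapPrefix P j x) j (P (x j)) = mapPrefix P (j + 1) x := by
  ext l
  rcases eq_or_ne l j with rfl | h
  · simp [mapPrefix]
  · have : (l : ℕ) ≠ j := fun h' => h (Fin.ext h')
    have : (l : ℕ) < j + 1 ↔ (l : ℕ) < j := by omega
    simp [mapPrefix, h, this]

/-- Replacing every variable by its image under a linear map `P` such that `1 - P` has rank at
most `d` changes a multilinear form by partition rank at most `k * d`. -/
theorem IsMultilinear.prankDecompOn_sub_comp (hk : 2 ≤ k) {α : (Fin k → V) → ZMod 2}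
    (hα : IsMultilinear k α) (P : V →ₗ[ZMod 2] V) {d : ℕ} (e : Fin d → V)
    (φ : Fin d → V →ₗ[ZMod 2] ZMod 2) (hP : ∀ x, x - P x = ∑ t, φ t x • e t) :
    PrankDecompOn k univ (k * d) fun x => α x - α fun i => P (x i) := by
  have key := PrankDecompOn.of_fintype (V := V) (k := k) (S := univ) (ι := Fin k × Fin d)
    (α := fun x => α x - α fun i => P (x i)) (fun p => {p.1}) (fun p x => φ p.2 (x p.1))
    (fun p x => α (Function.update (mapPrefix P p.1 x) p.1 (e p.2)))
    (fun p => subset_univ _) (fun p => singleton_ne_empty _)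
    (fun p h => by
      have := congrArg Finset.card h
      simp at this
      omega)
    (fun p => ⟨fun x y h => by simp only [h _ (mem_singleton_self _)], fun i hi x u v => by
      obtain rfl := mem_singleton.1 hi
      simp⟩)
    (fun p => ⟨fun x y h => by
        refine congrArg α (funext fun l => ?_)
        rcases eq_or_ne l p.1 with rfl | hl
        · simp
        · simp [hl, mapPrefix, h l (by simp [hl])],
      fun i hi x u v => by
        have hi : i ≠ p.1 := by simpa using hi
        simp only [mapPrefix_update, Function.update_comm hi]
        rw [← hα.2 i (mem_univ i)]
        split_ifs <;> simp⟩)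
    (fun x => ?_)
  · simpa using key
  · have h0 : α x = α (mapPrefix P 0 x) :=
      congrArg α (funext fun i => by simp [mapPrefix])
    have h1 : (α fun i => P (x i)) = α (mapPrefix P k x) :=
      congrArg α (funext fun i => by simp [mapPrefix])
    rw [Fintype.sum_prod_type, h0, h1,
      ← Finset.sum_range_sub' (fun j => α (mapPrefix P j x)), Finset.sum_range]
    refine Finset.sum_congr rfl fun j _ => ?_
    let f := MultilinearOn.slice hα (mapPrefix P j x) (mem_univ j)
    have hf : ∀ u, f u = α (Function.update (mapPrefix P j x) j u) := fun _ => rfl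
    rw [← update_mapPrefix_map, ← hf, ← update_mapPrefix_self P j x, ← hf, ← map_sub, hP, map_sum]
    refine Finset.sum_congr rfl fun t _ => ?_
    rw [ZMod.map_smul, smul_eq_mul, hf]

theorem IsMultilinear.exists_prankDecompOn [Module.Finite (ZMod 2) V] (hk : 2 ≤ k)
    {α : (Fin k → V) → ZMod 2} (hα : IsMultilinear k α) : ∃ m, PrankDecompOn k univ m α := by
  let b := Module.finBasis (ZMod 2) V
  have h := hα.prankDecompOn_sub_comp hk 0 b b.coord fun x => by simp [b.sum_repr x]
  have h0 : (α fun _ => (0 : V)) = 0 := by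
    have := (MultilinearOn.slice hα (fun _ => (0 : V)) (mem_univ ⟨0, by omega⟩)).map_zero
    simpa [MultilinearOn.slice, Function.update_eq_self_iff.2] using this
  exact ⟨_, by simpa [h0] using h⟩

theorem IsMultilinear.add {α β : (Fin k → V) → ZMod 2} (hα : IsMultilinear k α)
    (hβ : IsMultilinear k β) : IsMultilinear k (α + β) :=
  ⟨fun x y h => by simp only [Pi.add_apply, hα.1 x y h, hβ.1 x y h], fun i hi x u v => by
    simp only [Pi.add_apply, hα.2 i hi, hβ.2 i hi]
    ring⟩

theorem prank_zero : prank k (0 : (Fin k → V) → ZMod 2) = 0 :=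
  Nat.sInf_eq_zero.2 <| Or.inl
    ⟨Fin.elim0, Fin.elim0, Fin.elim0, fun i => i.elim0, fun i => i.elim0, fun i => i.elim0,
      fun i => i.elim0, fun i => i.elim0, fun x => by simp⟩

end PartitionRank

/-- **Corollary 14 (inheriting symmetry from a subspace).**
If `U ≤ G` has codimension `d` and the restriction of `α` to `U` is within partition
rank `r` of a symmetric multilinear form `σ` on `U`, then `α` is within partition rank
`k·d + r` of a symmetric multilinear form on `G`. -/
theorem statement9 (n k d r : ℕ) (α : (Fin k → (Fin n → ZMod 2)) → ZMod 2)
    (hα : IsMultilinear k α) (U : Submodule (ZMod 2) (Fin n → ZMod 2))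
    (hd : Module.finrank (ZMod 2) ((Fin n → ZMod 2) ⧸ U) = d)
    (σ : (Fin k → U) → ZMod 2) (hσ : IsMultilinear k σ) (hσs : SymmetricForm k σ)
    (hr : prank k ((fun x : Fin k → U => α fun i => (x i : Fin n → ZMod 2)) + σ) ≤ r) :
    ∃ σ' : (Fin k → (Fin n → ZMod 2)) → ZMod 2,
      IsMultilinear k σ' ∧ SymmetricForm k σ' ∧ prank k (α + σ') ≤ k * d + r := by
  rcases Nat.lt_or_ge k 2 with hk | hk
  · have : Subsingleton (Fin k) := Fin.subsingleton_iff_le_one.2 (by omega)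
    refine ⟨α, hα, fun π => ?_, ?_⟩
    · rw [Subsingleton.elim π 1]
      rfl
    · rw [CharTwo.add_self_eq_zero, prank_zero]
      exact Nat.zero_le _
  obtain ⟨g, hg⟩ := LinearMap.exists_leftInverse_of_injective U.subtype U.ker_subtype
  have hgU : ∀ u : U, g u = u := fun u => LinearMap.congr_fun hg u
  refine ⟨fun x => σ fun i => g (x i), MultilinearOn.comp_linearMap hσ g,
    fun π => funext fun x => congrFun (hσs π) fun i => g (x i), ?_⟩
  let P := U.subtype ∘ₗ g
  let L := U.liftQ (LinearMap.id - P) fun u hu => by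
    simp [P, hgU ⟨u, hu⟩]
  let b := Module.finBasisOfFinrankEq (ZMod 2) ((Fin n → ZMod 2) ⧸ U) hd
  have hdiff := hα.prankDecompOn_sub_comp hk P (fun t => L (b t)) (fun t => b.coord t ∘ₗ U.mkQ)
    fun x => by
      have : L (∑ t, b.repr (U.mkQ x) t • b t) = x - P x := by
        rw [b.sum_repr]
        rfl
      rw [← this, map_sum]
      simp
  have hres := Nat.sInf_mem
    (IsMultilinear.add (MultilinearOn.comp_linearMap hα U.subtype) hσ |>.exists_prankDecompOn hk)
  have hsum := hdiff.add (PrankDecompOn.comp_linearMap hres g)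
  refine le_trans (Nat.sInf_le ?_) (Nat.add_le_add_left hr (k * d))
  have heq : (α + fun x => σ fun i => g (x i)) = (fun x => α x - α fun i => P (x i)) +
      fun x => ((fun y : Fin k → U => α fun i => U.subtype (y i)) + σ) fun i => g (x i) := by
    ext x
    simp [P]
    ring
  rw [heq]
  exact hsum
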